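/- arXiv:math/9909185 — 3 statements merged into one kernel-verified Lean document; each statement's English description precedes it below -/
import Mathlib

section
/- Let Γ be a finite connected simple graph on v ≥ 4 vertices and let g be an equicut scale-t embedding of Γ into the n-cube with no constant coordinate. Then 2n ≤ t·v, and if 2n = t·v then Γ is isomorphic to the cycle C_v on v vertices. -/
/-- `g` is a scale-`t` embedding of the graph `G` into the `n`-cube: the Hamming
distance between images equals `t` times the graph distance. -/
def IsScaleEmbedding {V : Type*} [Fintype V] (G : SimpleGraph V) (t n : ℕ)
    (g : V → (Fin n → Bool)) : Prop :=
  ∀ x y : V, hammingDist (g x) (g y) = t * G.dist x y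

/-- The Wiener number of a graph: the sum of the graph distances over all
unordered pairs of vertices. -/
noncomputable def wiener {V : Type*} [Fintype V] (G : SimpleGraph V) : ℕ :=
  ∑ p ∈ Finset.univ.sym2,
    Sym2.lift ⟨fun x y => G.dist x y, fun _ _ => G.dist_comm⟩ p

/-- An embedding `g` of a graph on vertex set `V` into the `n`-cube is *equicut* if
every coordinate takes the value `true` on `⌊v/2⌋` or `⌈v/2⌉` vertices, where
`v = |V|`. -/
def IsEquicut {V : Type*} [Fintype V] [DecidableEq V] (n : ℕ)
    (g : V → (Fin n → Bool)) : Prop :=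
  ∀ i : Fin n, (Finset.univ.filter (fun x : V => g x i = true)).card = Fintype.card V / 2 ∨
    (Finset.univ.filter (fun x : V => g x i = true)).card = (Fintype.card V + 1) / 2

open Finset in
/-- If `w` lies metrically between `x` and `z` in the cube, then `w` agrees with `x` wherever `x`
and `z` agree. -/
lemma eq_of_hammingDist_add {n : ℕ} {a b c : Fin n → Bool}
    (h : hammingDist a c = hammingDist a b + hammingDist b c) {i : Fin n} (hi : a i = c i) :
    b i = a i := by
  by_contra hne
  have hsub : ({j | a j ≠ c j} : Finset (Fin n)) ⊆
      (({j | a j ≠ b j} : Finset (Fin n)) ∪ ({j | b j ≠ c j} : Finset (Fin n))).erase i := by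
    intro j hj
    simp only [mem_filter, mem_univ, true_and, mem_erase, mem_union] at hj ⊢
    refine ⟨fun e => hj (e ▸ hi), ?_⟩
    by_contra! hc
    exact hj (hc.1.trans hc.2)
  have hmem : i ∈ ({j | a j ≠ b j} : Finset (Fin n)) ∪ ({j | b j ≠ c j} : Finset (Fin n)) := by
    simp [Ne.symm hne]
  have h1 := card_le_card hsub
  have h2 := card_erase_lt_of_mem hmem
  have h3 := card_union_le ({j | a j ≠ b j} : Finset (Fin n)) ({j | b j ≠ c j} : Finset (Fin n))
  simp only [hammingDist] at h
  omega

open Finset in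
lemma sum_sub_two_mul (v N : ℕ) (h : v ≤ N) :
    ∑ k ∈ range N, (v - 1 - 2 * k) = v / 2 * ((v + 1) / 2) := by
  induction v using Nat.twoStepInduction generalizing N with
  | zero => simp
  | one => simp
  | more v ih _ =>
    obtain ⟨M, rfl⟩ : ∃ M, N = M + 1 := ⟨N - 1, by omega⟩
    rw [sum_range_succ', show (v + 2) / 2 = v / 2 + 1 by omega,
      show (v + 2 + 1) / 2 = (v + 1) / 2 + 1 by omega,
      sum_congr rfl (g := fun k => v - 1 - 2 * k) (fun k _ => by omega), ih M (by omega)]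
    have : v = v / 2 + (v + 1) / 2 := by omega
    simp only [mul_zero]
    ring_nf
    omega

open Finset in
lemma sum_eq_sum_card_lt {V : Type*} [Fintype V] (f : V → ℕ) (N : ℕ) (h : ∀ y, f y ≤ N) :
    ∑ y, f y = ∑ k ∈ range N, #{y | k < f y} := by
  simp_rw [card_filter]
  rw [sum_comm]
  refine sum_congr rfl fun y _ => ?_
  rw [← card_filter, show ({k ∈ range N | k < f y} : Finset ℕ) = range (f y) by
    ext k; have := h y; simp; omega, card_range]

namespace SimpleGraph

variable {V : Type*} {G : SimpleGraph V}

/-- A shortest walk leaving `A` passes through `w` if `w` is the only way out of `A`. -/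
lemma Connected.dist_eq_add_of_separates (hconn : G.Connected) {A : Set V} {w x y : V}
    (hA : ∀ a ∈ A, ∀ b ∉ A, G.Adj a b → b = w) (hx : x ∈ A) (hy : y ∉ A) :
    G.dist x y = G.dist x w + G.dist w y := by
  classical
  obtain ⟨p, hp⟩ := hconn.exists_walk_length_eq_dist x y
  obtain ⟨d, hd, h1, h2⟩ := p.exists_boundary_dart A hx hy
  have hw : w ∈ p.support := hA _ h1 _ h2 d.adj ▸ p.dart_snd_mem_support_of_mem_darts hd
  have h3 := congrArg Walk.length (p.take_spec hw)
  rw [Walk.length_append] at h3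
  have := dist_le (p.takeUntil w hw)
  have := dist_le (p.dropUntil w hw)
  have := hconn.dist_triangle (u := x) (v := w) (w := y)
  omega

/-- The way out `w` of `A` has a neighbour in `A`. -/
lemma Connected.exists_adj_of_separates (hconn : G.Connected)
    {A : Finset V} (hne : A.Nonempty) {w : V} (hw : w ∉ A)
    (hA : ∀ a ∈ A, ∀ b ∉ A, G.Adj a b → b = w) : ∃ x ∈ A, G.Adj x w := by
  obtain ⟨a, ha⟩ := hne
  obtain ⟨p⟩ := hconn a w
  obtain ⟨d, -, h1, h2⟩ := p.exists_boundary_dart (A : Set V) (by simpa) (by simpa)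
  exact ⟨d.fst, by simpa using h1, hA _ (by simpa using h1) _ (by simpa using h2) d.adj ▸ d.adj⟩

lemma Connected.exists_dist_eq (hconn : G.Connected) {x y : V} {k : ℕ} (h0 : 0 < k)
    (hk : k < G.dist x y) : ∃ w, G.dist x w = k := by
  obtain ⟨p⟩ := hconn x y
  obtain ⟨d, -, h1, h2⟩ := p.exists_boundary_dart {z | G.dist x z < k} (by simpa) (by simp; omega)
  simp only [Set.mem_ofPred_eq] at h1 h2
  have := d.adj.diff_dist_adj (u := x)
  exact ⟨d.snd, by omega⟩

lemma degree_cycleGraph {n : ℕ} (hn : 2 < n) (a : Fin n) : (cycleGraph n).degree a = 2 := by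
  obtain ⟨m, rfl⟩ : ∃ m, n = m + 3 := ⟨n - 3, by omega⟩
  exact cycleGraph_degree_three_le

/-- A connected graph in which every vertex has exactly two neighbours is a cycle. -/
lemma Connected.nonempty_iso_cycleGraph [Fintype V] (hconn : G.Connected)
    (h2 : ∀ x, (G.neighborSet x).ncard = 2) :
    Nonempty (G ≃g cycleGraph (Fintype.card V)) := by
  classical
  obtain ⟨x⟩ := hconn.nonempty
  have hcyc : G.IsCycles := fun x _ => h2 x
  obtain ⟨p, hp, hverts⟩ := hcyc.exists_cycle_toSubgraph_verts_eq_connectedComponentSupp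
    (v := x) (c := G.connectedComponentMk x) rfl
    (Set.nonempty_of_ncard_ne_zero (by rw [h2]; decide))
  have hmem : ∀ y, y ∈ p.support := fun y => by
    rw [← Walk.mem_verts_toSubgraph, hverts]
    exact ConnectedComponent.sound (hconn y x)
  have hham : p.IsHamiltonianCycle := by
    refine ⟨hp, hp.isPath_tail.isHamiltonian_of_mem fun y => ?_⟩
    rw [Walk.support_tail_of_not_nil p hp.not_nil]
    by_cases hxy : y = x
    · exact hxy ▸ Walk.end_mem_tail_support hp.not_nil
    · have := hmem y
      rw [Walk.mem_support_iff] at this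
      exact this.resolve_left hxy
  have hlen := hham.length_eq
  have h3 : 2 < Fintype.card V := hlen ▸ hp.three_le_length
  obtain ⟨f⟩ := (cycleGraph_isContained_iff h3).2 ⟨x, p, hp, hlen⟩
  have hbij : Function.Bijective f :=
    (Fintype.bijective_iff_injective_and_card _).2 ⟨f.injective, by simp⟩
  refine ⟨RelIso.symm ⟨Equiv.ofBijective f hbij, fun {a b} => ⟨fun hab => ?_, f.toHom.map_adj⟩⟩⟩
  have hset : f '' (cycleGraph (Fintype.card V)).neighborSet a = G.neighborSet (f a) := by
    refine Set.eq_of_subset_of_ncard_le ?_ ?_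
    · rintro _ ⟨c, hc, rfl⟩
      exact f.toHom.map_adj hc
    · rw [h2, Set.ncard_image_of_injective _ hbij.injective, ← Nat.card_coe_set_eq,
        Nat.card_eq_fintype_card, card_neighborSet_eq_degree]
      exact (degree_cycleGraph h3 a).ge
  have : f b ∈ G.neighborSet (f a) := hab
  rw [← hset] at this
  obtain ⟨c, hc, hcb⟩ := this
  exact f.injective hcb ▸ hc

section Levels

variable [Fintype V]

open Finset

/-- If no intermediate distance level from `x` is a single vertex, the number of vertices further
than `k` from `x` drops by at least two with each step. -/
lemma card_dist_gt_le {x : V}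
    (hlev : ∀ k, 0 < k → (∃ y, k < G.dist x y) → 2 ≤ #{y | G.dist x y = k}) (k : ℕ) :
    #{y | k < G.dist x y} ≤ Fintype.card V - 1 - 2 * k := by
  classical
  induction k with
  | zero =>
    have : ({y | 0 < G.dist x y} : Finset V) ⊆ univ.erase x := fun y hy => by
      simp only [mem_filter, mem_univ, true_and, mem_erase, and_true] at hy ⊢
      rintro rfl
      simp at hy
    simpa using card_le_card this
  | succ k ih =>
    rcases Finset.eq_empty_or_nonempty ({y | k + 1 < G.dist x y} : Finset V) with h | ⟨y, hy⟩
    · simp [h]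
    have h2 := hlev (k + 1) k.succ_pos ⟨y, by simpa using hy⟩
    have hdisj : Disjoint ({y | k + 1 < G.dist x y} : Finset V) ({y | G.dist x y = k + 1} : Finset V) := by
      rw [disjoint_filter]; intro y _ h; omega
    have hun : ({y | k + 1 < G.dist x y} : Finset V) ∪ ({y | G.dist x y = k + 1} : Finset V) =
        ({y | k < G.dist x y} : Finset V) := by
      ext y; simp only [mem_union, mem_filter, mem_univ, true_and]; omega
    have := card_union_of_disjoint hdisj
    rw [hun] at this
    omega

lemma dist_le_card_add_sum (x y : V) :
    G.dist x y ≤ Fintype.card V + ∑ z, G.dist x z :=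
  (single_le_sum (f := fun z => G.dist x z) (fun _ _ => Nat.zero_le _) (mem_univ y)).trans
    (Nat.le_add_left _ _)

lemma sum_dist_le {x : V}
    (hlev : ∀ k, 0 < k → (∃ y, k < G.dist x y) → 2 ≤ #{y | G.dist x y = k}) :
    ∑ y, G.dist x y ≤ Fintype.card V / 2 * ((Fintype.card V + 1) / 2) := by
  rw [sum_eq_sum_card_lt _ _ (dist_le_card_add_sum x),
    ← sum_sub_two_mul _ (Fintype.card V + ∑ z, G.dist x z) (Nat.le_add_right _ _)]
  exact sum_le_sum fun k _ => card_dist_gt_le hlev k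

lemma ncard_neighborSet_eq_two {x : V}
    (hlev : ∀ k, 0 < k → (∃ y, k < G.dist x y) → 2 ≤ #{y | G.dist x y = k})
    (hcard : 4 ≤ Fintype.card V)
    (hsum : ∑ y, G.dist x y = Fintype.card V / 2 * ((Fintype.card V + 1) / 2)) :
    (G.neighborSet x).ncard = 2 := by
  classical
  rw [sum_eq_sum_card_lt _ _ (dist_le_card_add_sum x),
    ← sum_sub_two_mul _ (Fintype.card V + ∑ z, G.dist x z) (Nat.le_add_right _ _),
    sum_eq_sum_iff_of_le fun k _ => card_dist_gt_le hlev k] at hsum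
  have h0 := hsum 0 (by rw [mem_range]; omega)
  have h1 := hsum 1 (by rw [mem_range]; omega)
  have hdisj : Disjoint ({y | 1 < G.dist x y} : Finset V) ({y | G.dist x y = 1} : Finset V) := by
    rw [disjoint_filter]; intro y _ h; omega
  have hun : ({y | 1 < G.dist x y} : Finset V) ∪ ({y | G.dist x y = 1} : Finset V) =
      ({y | 0 < G.dist x y} : Finset V) := by
    ext y; simp only [mem_union, mem_filter, mem_univ, true_and]; omega
  have hc := card_union_of_disjoint hdisj
  rw [hun] at hc
  have hN : G.neighborSet x = (({y | G.dist x y = 1} : Finset V) : Set V) := by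
    ext y; simp
  rw [hN, Set.ncard_coe_finset]
  omega

end Levels

end SimpleGraph

section Equicut

open Finset SimpleGraph

variable {V : Type*} [Fintype V] {G : SimpleGraph V} {t n : ℕ} {g : V → (Fin n → Bool)}

/-- The vertices agreeing with `x` in a coordinate of an equicut embedding form a balanced half. -/
lemma IsEquicut.card_eq [DecidableEq V] (heq : IsEquicut n g) (i : Fin n) (b : Bool) :
    #{y | g y i = b} = Fintype.card V / 2 ∨ #{y | g y i = b} = (Fintype.card V + 1) / 2 := by
  have h := heq i
  cases b with
  | true => exact h
  | false =>
    have := card_filter_add_card_filter_not (s := (univ : Finset V)) (fun y => g y i = true)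
    simp only [Bool.not_eq_true, card_univ] at this
    omega

lemma IsScaleEmbedding.injective (hg : IsScaleEmbedding G t n g) (hconn : G.Connected)
    (ht : 1 ≤ t) : Function.Injective g := fun x y hxy => by
  have := hg x y
  rw [hxy, hammingDist_self, eq_comm, Nat.mul_eq_zero] at this
  exact hconn.dist_eq_zero_iff.1 (this.resolve_left (by omega))

/-- If `w` is the only way out of `A`, a coordinate separating `w` from a vertex of `A`
cuts out a subset of `A`. -/
lemma IsScaleEmbedding.filter_subset (hg : IsScaleEmbedding G t n g) (hconn : G.Connected)
    {A : Finset V} {w x : V} (hA : ∀ a ∈ A, ∀ b ∉ A, G.Adj a b → b = w) (hx : x ∈ A) {i : Fin n}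
    (hi : g x i ≠ g w i) : ({y | g y i = g x i} : Finset V) ⊆ A := by
  intro y hy
  by_contra hyA
  have hd := hconn.dist_eq_add_of_separates (A := (A : Set V)) (w := w)
    (by simpa using hA) (by simpa using hx) (y := y) (by simpa using hyA)
  refine hi (eq_of_hammingDist_add (a := g x) (b := g w) (c := g y) ?_ ?_).symm
  · rw [hg, hg, hg, hd, mul_add]
  · simpa [eq_comm] using hy

lemma IsScaleEmbedding.exists_ne (hg : IsScaleEmbedding G t n g) (hconn : G.Connected)
    (ht : 1 ≤ t) {x w : V} (h : x ≠ w) : ∃ i, g x i ≠ g w i := by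
  by_contra! hc
  exact h (hg.injective hconn ht (funext hc))

lemma IsScaleEmbedding.half_le_card [DecidableEq V] (hg : IsScaleEmbedding G t n g)
    (heq : IsEquicut n g) (hconn : G.Connected) (ht : 1 ≤ t) {A : Finset V} (hne : A.Nonempty)
    {w : V} (hw : w ∉ A) (hA : ∀ a ∈ A, ∀ b ∉ A, G.Adj a b → b = w) :
    Fintype.card V / 2 ≤ #A := by
  obtain ⟨x, hx, hadj⟩ := hconn.exists_adj_of_separates hne hw hA
  obtain ⟨i, hi⟩ := hg.exists_ne hconn ht hadj.ne
  have h1 := card_le_card (hg.filter_subset hconn hA hx hi)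
  have h2 := heq.card_eq i (g x i)
  omega

lemma IsScaleEmbedding.half_lt_card [DecidableEq V] (hg : IsScaleEmbedding G t n g)
    (heq : IsEquicut n g) (hconn : G.Connected) (ht : 1 ≤ t) (hcard : 4 ≤ Fintype.card V)
    {A : Finset V} (hne : A.Nonempty) {w : V} (hw : w ∉ A)
    (hA : ∀ a ∈ A, ∀ b ∉ A, G.Adj a b → b = w) :
    Fintype.card V / 2 < #A := by
  by_contra! hle
  obtain ⟨x, hx, hadj⟩ := hconn.exists_adj_of_separates hne hw hA
  have hhalf : ∀ i, g x i ≠ g w i → ({y | g y i = g x i} : Finset V) = A := fun i hi => by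
    refine eq_of_subset_of_card_le (hg.filter_subset hconn hA hx hi) ?_
    have := heq.card_eq i (g x i)
    omega
  have huniq : ∀ a ∈ A, G.Adj a w → a = x := by
    intro a ha haw
    have hsub : ({i | g x i ≠ g w i} : Finset (Fin n)) ⊆
        ({i | g a i ≠ g w i} : Finset (Fin n)) := by
      intro i hi
      simp only [mem_filter, mem_univ, true_and] at hi ⊢
      rw [← hhalf i hi, mem_filter] at ha
      rwa [ha.2]
    have heq' := eq_of_subset_of_card_le hsub (by
      have h1 := hg x w
      have h2 := hg a w
      rw [dist_eq_one_iff_adj.2 hadj] at h1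
      rw [dist_eq_one_iff_adj.2 haw] at h2
      simp only [hammingDist] at h1 h2
      omega)
    refine hg.injective hconn ht (funext fun i => ?_)
    have hi := Finset.ext_iff.1 heq' i
    simp only [mem_filter, mem_univ, true_and] at hi
    revert hi
    cases g x i <;> cases g a i <;> cases g w i <;> simp
  have hcardA := hg.half_le_card heq hconn ht hne hw hA
  have herase : #(A.erase x) = #A - 1 := card_erase_of_mem hx
  have := hg.half_le_card heq hconn ht (A := A.erase x) (w := x)
    (card_pos.1 (by omega)) (notMem_erase _ _) (by
      intro a ha b hb hab
      by_contra hbx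
      have hbA : b ∉ A := fun h => hb (mem_erase.2 ⟨hbx, h⟩)
      obtain rfl := hA a (mem_of_mem_erase ha) b hbA hab
      exact ne_of_mem_erase ha (huniq a (mem_of_mem_erase ha) hab))
  omega

/-- Intermediate distance levels of an equicut graph have at least two vertices. -/
lemma IsScaleEmbedding.two_le_card_level [DecidableEq V] (hg : IsScaleEmbedding G t n g)
    (heq : IsEquicut n g) (hconn : G.Connected) (ht : 1 ≤ t) (hcard : 4 ≤ Fintype.card V)
    {x : V} {k : ℕ} (h0 : 0 < k) (hk : ∃ y, k < G.dist x y) :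
    2 ≤ #{y | G.dist x y = k} := by
  obtain ⟨y, hy⟩ := hk
  obtain ⟨w, hw⟩ := hconn.exists_dist_eq h0 hy
  by_contra! hlt
  have huniq : ∀ z, G.dist x z = k → z = w := fun z hz =>
    card_le_one.1 (by omega : #{y | G.dist x y = k} ≤ 1) z (by simpa) w (by simpa)
  have hlow := hg.half_lt_card heq hconn ht hcard (A := {z | G.dist x z < k}) (w := w)
    ⟨x, by simpa⟩ (by simp [hw]) (by
      intro a ha b hb hab
      simp only [mem_filter, mem_univ, true_and] at ha hb
      have := hab.diff_dist_adj (u := x)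
      exact huniq b (by omega))
  have hhigh := hg.half_lt_card heq hconn ht hcard (A := {z | k < G.dist x z}) (w := w)
    ⟨y, by simpa⟩ (by simp [hw]) (by
      intro a ha b hb hab
      simp only [mem_filter, mem_univ, true_and] at ha hb
      have := hab.symm.diff_dist_adj (u := x)
      exact huniq b (by omega))
  have hdisj : Disjoint ({z | G.dist x z < k} : Finset V) ({z | k < G.dist x z} : Finset V) := by
    rw [disjoint_filter]; intro z _ h; omega
  have := card_union_of_disjoint hdisj
  have := card_le_univ (({z | G.dist x z < k} : Finset V) ∪ ({z | k < G.dist x z} : Finset V))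
  omega

/-- The number of ordered pairs of vertices separated by a coordinate of an equicut embedding. -/
lemma IsEquicut.sum_ite_ne [DecidableEq V] (heq : IsEquicut n g) (i : Fin n) :
    ∑ x, ∑ y, (if g x i ≠ g y i then 1 else 0) =
      2 * (Fintype.card V / 2 * ((Fintype.card V + 1) / 2)) := by
  have hsplit := card_filter_add_card_filter_not (s := (univ : Finset V)) (fun y => g y i = true)
  simp only [Bool.not_eq_true, card_univ] at hsplit
  have hrow : ∀ x, ∑ y, (if g x i ≠ g y i then 1 else 0) =
      if g x i = true then #{y | g y i = false} else #{y | g y i = true} := by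
    intro x
    rw [← card_filter]
    cases g x i <;> simp
  simp_rw [hrow]
  rw [sum_ite]
  simp only [Bool.not_eq_true, sum_const, smul_eq_mul]
  rcases heq i with h | h
  · rw [h] at hsplit ⊢
    rw [show #{y | g y i = false} = (Fintype.card V + 1) / 2 by omega]
    ring
  · rw [h] at hsplit ⊢
    rw [show #{y | g y i = false} = Fintype.card V / 2 by omega]
    ring

/-- Counting separated ordered pairs by coordinates computes the total distance. -/
lemma IsScaleEmbedding.mul_sum_dist [DecidableEq V] (hg : IsScaleEmbedding G t n g)
    (heq : IsEquicut n g) :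
    t * ∑ x, ∑ y, G.dist x y =
      2 * n * (Fintype.card V / 2 * ((Fintype.card V + 1) / 2)) := by
  have h : ∀ x y, t * G.dist x y = ∑ i, if g x i ≠ g y i then 1 else 0 := fun x y => by
    rw [← hg, hammingDist, card_filter]
  simp_rw [mul_sum, h]
  rw [sum_congr rfl fun x _ => sum_comm, sum_comm]
  simp_rw [heq.sum_ite_ne]
  rw [sum_const, card_univ, Fintype.card_fin, smul_eq_mul]
  ring

end Equicut

/-- For a connected graph `Γ` on `v ≥ 4` vertices with an equicut scale-`t` embedding
into the `n`-cube having no constant coordinate, `2n ≤ t·v`, and if equality holds then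
`Γ` is isomorphic to the cycle `C_v`. -/
theorem equicut_upper_size {V : Type*} [Fintype V] [DecidableEq V]
    (G : SimpleGraph V) (hconn : G.Connected) (v t n : ℕ)
    (hv : Fintype.card V = v) (hv4 : 4 ≤ v)
    (ht : 1 ≤ t) (g : V → (Fin n → Bool))
    (hg : IsScaleEmbedding G t n g) (heq : IsEquicut n g)
    (hnc : ∀ i : Fin n, ∃ x y : V, g x i ≠ g y i) :
    2 * n ≤ t * v ∧
      (2 * n = t * v → Nonempty (G ≃g SimpleGraph.cycleGraph v)) := by
  subst hv
  have hlev : ∀ x k, 0 < k → (∃ y, k < G.dist x y) →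
      2 ≤ (Finset.univ.filter fun y => G.dist x y = k).card :=
    fun x k h0 hk => hg.two_le_card_level heq hconn ht hv4 h0 hk
  have hle := fun x => SimpleGraph.sum_dist_le (hlev x)
  have htotal := hg.mul_sum_dist heq
  have hq : 0 < Fintype.card V / 2 * ((Fintype.card V + 1) / 2) :=
    Nat.mul_pos (by omega) (by omega)
  have hsum : ∑ x, ∑ y, G.dist x y ≤
      ∑ _x : V, Fintype.card V / 2 * ((Fintype.card V + 1) / 2) :=
    Finset.sum_le_sum fun x _ => hle x
  have hconst : ∑ _x : V, Fintype.card V / 2 * ((Fintype.card V + 1) / 2) =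
      Fintype.card V * (Fintype.card V / 2 * ((Fintype.card V + 1) / 2)) := by
    rw [Finset.sum_const, Finset.card_univ, smul_eq_mul]
  refine ⟨?_, fun h => ?_⟩
  · refine Nat.le_of_mul_le_mul_right ?_ hq
    rw [← htotal, mul_assoc, ← hconst]
    exact Nat.mul_le_mul_left t hsum
  · rw [h, mul_assoc, ← hconst] at htotal
    have heach := (Finset.sum_eq_sum_iff_of_le fun x _ => hle x).1
      (Nat.eq_of_mul_eq_mul_left (by omega) htotal)
    exact hconn.nonempty_iso_cycleGraph fun x =>
      SimpleGraph.ncard_neighborSet_eq_two (hlev x) hv4 (heach x (Finset.mem_univ x))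
end

section
/- Let Γ be a finite connected simple graph with at least 2 vertices and diameter D ≥ 1 satisfying conditions (I) and (II). Then the diametral doubling □Γ is connected of diameter D + 1, and □Γ itself satisfies conditions (I) and (II) (with D replaced by D + 1). -/
/-- The diametral doubling `□Γ` of a graph `Γ` with diameter `D`: two copies of the
vertex set; within each copy the adjacency of `Γ`, and across the copies `x⁺ ~ y⁻`
iff `d_Γ(x,y) = D`. -/
def doubling {V : Type*} (G : SimpleGraph V) (D : ℕ) : SimpleGraph (V ⊕ V) :=
  SimpleGraph.fromRel (fun u w => match u, w with
    | Sum.inl x, Sum.inl y => G.Adj x y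
    | Sum.inr x, Sum.inr y => G.Adj x y
    | Sum.inl x, Sum.inr y => G.dist x y = D
    | Sum.inr _, Sum.inl _ => False)

/-- Condition (I): for all vertices `x, y, z₁, z₂` with `d(x,z₁) = D` and
`d(y,z₂) = D` one has `d(x,y) ≤ 2 + d(z₁,z₂)`. -/
def CondI {W : Type*} (H : SimpleGraph W) (D : ℕ) : Prop :=
  ∀ x y z₁ z₂ : W, H.dist x z₁ = D → H.dist y z₂ = D →
    H.dist x y ≤ 2 + H.dist z₁ z₂

/-- Condition (II): every pair of vertices lies on a geodesic of length `D`. -/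
def CondII {W : Type*} (H : SimpleGraph W) (D : ℕ) : Prop :=
  ∀ x y : W, ∃ z₁ z₂ : W, H.dist z₁ z₂ = D ∧
    H.dist z₁ x + H.dist x y + H.dist y z₂ = D

namespace doubling

variable {V : Type*} {G : SimpleGraph V} {D : ℕ}

@[simp] lemma adj_inl_inl {x y : V} :
    (doubling G D).Adj (Sum.inl x) (Sum.inl y) ↔ G.Adj x y := by
  simp only [doubling, SimpleGraph.fromRel_adj, ne_eq, Sum.inl.injEq, G.adj_comm y x, or_self]
  exact and_iff_right_of_imp fun h => h.ne

@[simp] lemma adj_inr_inr {x y : V} :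
    (doubling G D).Adj (Sum.inr x) (Sum.inr y) ↔ G.Adj x y := by
  simp only [doubling, SimpleGraph.fromRel_adj, ne_eq, Sum.inr.injEq, G.adj_comm y x, or_self]
  exact and_iff_right_of_imp fun h => h.ne

@[simp] lemma adj_inl_inr {x y : V} :
    (doubling G D).Adj (Sum.inl x) (Sum.inr y) ↔ G.dist x y = D := by
  simp [doubling]

@[simp] lemma adj_inr_inl {x y : V} :
    (doubling G D).Adj (Sum.inr x) (Sum.inl y) ↔ G.dist x y = D := by
  rw [SimpleGraph.adj_comm, adj_inl_inr, SimpleGraph.dist_comm]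

/-- The closed formula for distances in `doubling G D`: that of `G` within each copy, and
`D + 1` minus that of `G` across the copies. -/
noncomputable def distFormula (G : SimpleGraph V) (D : ℕ) : V ⊕ V → V ⊕ V → ℕ
  | Sum.inl x, Sum.inl y => G.dist x y
  | Sum.inr x, Sum.inr y => G.dist x y
  | Sum.inl x, Sum.inr y => D + 1 - G.dist x y
  | Sum.inr x, Sum.inl y => D + 1 - G.dist x y

lemma dist_add_dist_le (hconn : G.Connected) (hI : CondI G D) (hII : CondII G D)
    (x : V) {y z : V} (hyz : G.dist y z = D) : G.dist x y + G.dist x z ≤ D + 2 := by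
  obtain ⟨z₁, z₂, h, hsum⟩ := hII x z
  have hle := hI z₁ y z₂ z h hyz
  have htri := hconn.dist_triangle (u := x) (v := z₁) (w := y)
  rw [G.dist_comm (u := x) (v := z₁)] at htri
  rw [G.dist_comm (u := z₂) (v := z)] at hle
  omega

lemma distFormula_le_add_one (hconn : G.Connected) (hD1 : ∀ x y : V, G.dist x y ≤ D)
    (hI : CondI G D) (hII : CondII G D) (u : V ⊕ V) {v w : V ⊕ V}
    (h : (doubling G D).Adj v w) : distFormula G D u w ≤ distFormula G D u v + 1 := by
  have same (x : V) {y z : V} (h : G.Adj y z) : G.dist x z ≤ G.dist x y + 1 := by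
    simpa [SimpleGraph.dist_eq_one_iff_adj.mpr h] using
      hconn.dist_triangle (u := x) (v := y) (w := z)
  have cross (x : V) {y z : V} (h : G.dist y z = D) :
      D ≤ G.dist x y + G.dist x z ∧ G.dist x y + G.dist x z ≤ D + 2 := by
    refine ⟨?_, dist_add_dist_le hconn hI hII x h⟩
    simpa [h, G.dist_comm (u := y) (v := x)] using
      hconn.dist_triangle (u := y) (v := x) (w := z)
  rcases u with x | x <;> rcases v with y | y <;> rcases w with z | z <;>
    simp only [adj_inl_inl, adj_inr_inr, adj_inl_inr, adj_inr_inl] at h <;>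
    simp only [distFormula] <;>
    first
    | (have h₁ := same x h
       have h₂ := same x h.symm
       omega)
    | (have h₁ := cross x h
       have h₂ := hD1 x y
       have h₃ := hD1 x z
       omega)

lemma distFormula_self (u : V ⊕ V) : distFormula G D u u = 0 := by
  cases u <;> simp [distFormula]

lemma distFormula_le_length (hconn : G.Connected) (hD1 : ∀ x y : V, G.dist x y ≤ D)
    (hI : CondI G D) (hII : CondII G D) {u v w : V ⊕ V} (p : (doubling G D).Walk v w) :
    distFormula G D u w ≤ distFormula G D u v + p.length := by
  induction p with
  | nil => simp
  | cons h p ih =>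
    have := distFormula_le_add_one hconn hD1 hI hII u h
    rw [SimpleGraph.Walk.length_cons]
    omega

lemma exists_walk_inl_inl (hconn : G.Connected) (x y : V) :
    ∃ p : (doubling G D).Walk (Sum.inl x) (Sum.inl y), p.length = G.dist x y := by
  obtain ⟨p, hp⟩ := hconn.exists_walk_length_eq_dist x y
  let φ : G →g doubling G D := ⟨Sum.inl, adj_inl_inl.mpr⟩
  exact ⟨p.map φ, (p.length_map φ).trans hp⟩

lemma exists_walk_inr_inr (hconn : G.Connected) (x y : V) :
    ∃ p : (doubling G D).Walk (Sum.inr x) (Sum.inr y), p.length = G.dist x y := by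
  obtain ⟨p, hp⟩ := hconn.exists_walk_length_eq_dist x y
  let φ : G →g doubling G D := ⟨Sum.inr, adj_inr_inr.mpr⟩
  exact ⟨p.map φ, (p.length_map φ).trans hp⟩

lemma exists_walk_inl_inr (hconn : G.Connected) (hII : CondII G D) (x y : V) :
    ∃ p : (doubling G D).Walk (Sum.inl x) (Sum.inr y), p.length = D + 1 - G.dist x y := by
  obtain ⟨z₁, z₂, h, hsum⟩ := hII x y
  obtain ⟨p, hp⟩ := exists_walk_inl_inl (D := D) hconn x z₁
  obtain ⟨q, hq⟩ := exists_walk_inr_inr (D := D) hconn z₂ y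
  refine ⟨p.append (.cons (adj_inl_inr.mpr h) q), ?_⟩
  rw [G.dist_comm] at hp hq
  rw [SimpleGraph.Walk.length_append, SimpleGraph.Walk.length_cons]
  omega

lemma exists_walk_length_eq_distFormula (hconn : G.Connected) (hII : CondII G D)
    (u w : V ⊕ V) : ∃ p : (doubling G D).Walk u w, p.length = distFormula G D u w := by
  rcases u with x | x <;> rcases w with y | y
  · exact exists_walk_inl_inl hconn x y
  · exact exists_walk_inl_inr hconn hII x y
  · obtain ⟨p, hp⟩ := exists_walk_inl_inr hconn hII y x
    exact ⟨p.reverse, by simpa [distFormula, G.dist_comm (u := x)] using hp⟩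
  · exact exists_walk_inr_inr hconn x y

lemma connected (hconn : G.Connected) (hII : CondII G D) : (doubling G D).Connected := by
  have := hconn.nonempty
  exact ⟨fun u w => (exists_walk_length_eq_distFormula hconn hII u w).elim fun p _ => ⟨p⟩⟩

lemma dist_eq_distFormula (hconn : G.Connected) (hD1 : ∀ x y : V, G.dist x y ≤ D)
    (hI : CondI G D) (hII : CondII G D) (u w : V ⊕ V) :
    (doubling G D).dist u w = distFormula G D u w := by
  obtain ⟨p, hp⟩ := exists_walk_length_eq_distFormula hconn hII u w
  obtain ⟨q, hq⟩ := (connected hconn hII).exists_walk_length_eq_dist u w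
  refine le_antisymm (hp ▸ SimpleGraph.dist_le p) ?_
  simpa [distFormula_self, hq] using distFormula_le_length hconn hD1 hI hII (u := u) q

lemma distFormula_add_distFormula_swap (hD1 : ∀ x y : V, G.dist x y ≤ D) (u w : V ⊕ V) :
    distFormula G D u w + distFormula G D w u.swap = D + 1 := by
  rcases u with x | x <;> rcases w with y | y <;>
    simp only [distFormula, Sum.swap_inl, Sum.swap_inr, G.dist_comm (u := y) (v := x)] <;>
    have := hD1 x y <;> omega

lemma distFormula_swap_swap (u w : V ⊕ V) :
    distFormula G D u.swap w.swap = distFormula G D u w := by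
  cases u <;> cases w <;> rfl

lemma eq_swap_of_distFormula_eq (hconn : G.Connected) (hD1 : ∀ x y : V, G.dist x y ≤ D)
    {u w : V ⊕ V} (h : distFormula G D u w = D + 1) : w = u.swap := by
  rcases u with x | x <;> rcases w with y | y <;> simp only [distFormula] at h <;>
    have hle := hD1 x y
  · omega
  · rw [hconn.dist_eq_zero_iff.mp (show G.dist x y = 0 by omega), Sum.swap_inl]
  · rw [hconn.dist_eq_zero_iff.mp (show G.dist x y = 0 by omega), Sum.swap_inr]
  · omega

end doubling

/-- If `Γ` is connected of diameter `D ≥ 1` and satisfies conditions (I) and (II),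
then `□Γ` is connected of diameter `D + 1` and satisfies conditions (I) and (II)
with `D` replaced by `D + 1`. -/
theorem doubling_inherits {V : Type*} [Fintype V] (G : SimpleGraph V)
    (hconn : G.Connected) (hcard : 2 ≤ Fintype.card V) (D : ℕ) (hD : 1 ≤ D)
    (hD1 : ∀ x y : V, G.dist x y ≤ D) (hD2 : ∃ x y : V, G.dist x y = D)
    (hI : CondI G D) (hII : CondII G D) :
    (doubling G D).Connected ∧
      (∀ u w : V ⊕ V, (doubling G D).dist u w ≤ D + 1) ∧
      (∃ u w : V ⊕ V, (doubling G D).dist u w = D + 1) ∧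
      CondI (doubling G D) (D + 1) ∧ CondII (doubling G D) (D + 1) := by
  have hdist := doubling.dist_eq_distFormula hconn hD1 hI hII
  have hadd := doubling.distFormula_add_distFormula_swap hD1
  have hswap (u : V ⊕ V) : doubling.distFormula G D u u.swap = D + 1 := by
    simpa [doubling.distFormula_self] using hadd u u
  refine ⟨doubling.connected hconn hII, fun u w => ?_, ?_, fun x y z₁ z₂ h₁ h₂ => ?_,
    fun x y => ⟨x, x.swap, ?_, ?_⟩⟩
  · rw [hdist, ← hadd u w]
    exact Nat.le_add_right _ _
  · obtain ⟨x, -⟩ := hD2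
    exact ⟨Sum.inl x, Sum.inr x, (hdist _ _).trans (hswap (Sum.inl x))⟩
  · rw [hdist] at h₁ h₂
    rw [hdist, hdist, doubling.eq_swap_of_distFormula_eq hconn hD1 h₁,
      doubling.eq_swap_of_distFormula_eq hconn hD1 h₂, doubling.distFormula_swap_swap]
    exact Nat.le_add_left _ _
  · rw [hdist, hswap]
  · simpa only [hdist, doubling.distFormula_self, zero_add] using hadd x y
end

section
/- Let Γ be a finite connected simple graph on v vertices with diameter D ≥ 1 satisfying conditions (I) and (II), and suppose Γ admits a scale-t embedding into the n-cube with n ≤ t·(D+1). Then the diametral doubling □Γ admits a scale-t embedding h into the t·(D+1)-cube that is equicut; more precisely, for every coordinate i the number of vertices u of □Γ with h(u)_i = true equals v (half of the 2v vertices of □Γ). -/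
section Doubling

variable {V : Type*} {G : SimpleGraph V} {D : ℕ}

lemma doubling_adj_inl_inl {x y : V} :
    (doubling G D).Adj (Sum.inl x) (Sum.inl y) ↔ G.Adj x y := by
  simp only [doubling, SimpleGraph.fromRel_adj, ne_eq, Sum.inl.injEq]
  exact ⟨fun h => h.2.elim id SimpleGraph.Adj.symm, fun h => ⟨h.ne, Or.inl h⟩⟩

lemma doubling_adj_inr_inr {x y : V} :
    (doubling G D).Adj (Sum.inr x) (Sum.inr y) ↔ G.Adj x y := by
  simp only [doubling, SimpleGraph.fromRel_adj, ne_eq, Sum.inr.injEq]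
  exact ⟨fun h => h.2.elim id SimpleGraph.Adj.symm, fun h => ⟨h.ne, Or.inl h⟩⟩

lemma doubling_adj_inl_inr {x y : V} :
    (doubling G D).Adj (Sum.inl x) (Sum.inr y) ↔ G.dist x y = D := by
  simp [doubling, SimpleGraph.fromRel_adj]

lemma doubling_adj_inr_inl {x y : V} :
    (doubling G D).Adj (Sum.inr x) (Sum.inl y) ↔ G.dist x y = D := by
  rw [SimpleGraph.adj_comm, doubling_adj_inl_inr, SimpleGraph.dist_comm]

/-- The embedding of `Γ` in `□Γ` as the copy `V⁺`. -/
def doublingInl (G : SimpleGraph V) (D : ℕ) : G →g doubling G D where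
  toFun := Sum.inl
  map_rel' h := doubling_adj_inl_inl.2 h

/-- The embedding of `Γ` in `□Γ` as the copy `V⁻`. -/
def doublingInr (G : SimpleGraph V) (D : ℕ) : G →g doubling G D where
  toFun := Sum.inr
  map_rel' h := doubling_adj_inr_inr.2 h

/-- The distance function of `□Γ` under conditions (I) and (II), in terms of that of `Γ`. -/
noncomputable def doublingDist (G : SimpleGraph V) (D : ℕ) : V ⊕ V → V ⊕ V → ℕ
  | Sum.inl x, Sum.inl y => G.dist x y
  | Sum.inr x, Sum.inr y => G.dist x y
  | Sum.inl x, Sum.inr y => D + 1 - G.dist x y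
  | Sum.inr x, Sum.inl y => D + 1 - G.dist x y

lemma dist_add_dist_le_of_dist_eq_diam (hconn : G.Connected) (hI : CondI G D)
    (hII : CondII G D) {y z : V} (hyz : G.dist y z = D) (x : V) :
    G.dist x y + G.dist x z ≤ D + 2 := by
  obtain ⟨a, b, hab, hsum⟩ := hII x z
  have h₁ := hI y a z b hyz hab
  have h₂ := hconn.dist_triangle (u := x) (v := a) (w := y)
  rw [G.dist_comm (u := x) (v := a), G.dist_comm (u := a) (v := y)] at h₂
  omega

lemma doublingDist_le_succ (hconn : G.Connected) (hI : CondI G D) (hII : CondII G D)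
    (u : V ⊕ V) {v w : V ⊕ V} (h : (doubling G D).Adj v w) :
    doublingDist G D u w ≤ doublingDist G D u v + 1 := by
  have same : ∀ x {y z : V}, G.Adj y z →
      G.dist x z ≤ G.dist x y + 1 ∧ G.dist x y ≤ G.dist x z + 1 := fun x y z hyz => by
    have h₁ := hconn.dist_triangle (u := x) (v := y) (w := z)
    have h₂ := hconn.dist_triangle (u := x) (v := z) (w := y)
    rw [SimpleGraph.dist_eq_one_iff_adj.2 hyz] at h₁
    rw [SimpleGraph.dist_eq_one_iff_adj.2 hyz.symm] at h₂
    exact ⟨h₁, h₂⟩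
  have cross : ∀ x {y z : V}, G.dist y z = D →
      G.dist x y + G.dist x z ≤ D + 2 ∧ D ≤ G.dist x y + G.dist x z := fun x y z hyz => by
    have h₁ := hconn.dist_triangle (u := y) (v := x) (w := z)
    rw [hyz, G.dist_comm (u := y)] at h₁
    exact ⟨dist_add_dist_le_of_dist_eq_diam hconn hI hII hyz x, h₁⟩
  rcases u with x | x <;> rcases v with y | y <;> rcases w with z | z <;>
    simp only [doubling_adj_inl_inl, doubling_adj_inr_inr, doubling_adj_inl_inr,
      doubling_adj_inr_inl] at h <;>
    simp only [doublingDist] <;>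
    first
      | (have := same x h; omega)
      | (have := cross x h; omega)

lemma doublingDist_le_length (hconn : G.Connected) (hI : CondI G D) (hII : CondII G D)
    {u v : V ⊕ V} (p : (doubling G D).Walk u v) (w : V ⊕ V) :
    doublingDist G D w v ≤ doublingDist G D w u + p.length := by
  induction p with
  | nil => simp
  | cons h p ih =>
    have := doublingDist_le_succ hconn hI hII w h
    rw [SimpleGraph.Walk.length_cons]
    omega

lemma exists_walk_length_eq_doublingDist (hconn : G.Connected) (hII : CondII G D)
    (u v : V ⊕ V) : ∃ p : (doubling G D).Walk u v, p.length = doublingDist G D u v := by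
  have walk_inl : ∀ x y : V, ∃ p : (doubling G D).Walk (Sum.inl x) (Sum.inl y),
      p.length = G.dist x y := fun x y => by
    obtain ⟨p, hp⟩ := hconn.exists_walk_length_eq_dist x y
    exact ⟨p.map (doublingInl G D), (p.length_map _).trans hp⟩
  have walk_inr : ∀ x y : V, ∃ p : (doubling G D).Walk (Sum.inr x) (Sum.inr y),
      p.length = G.dist x y := fun x y => by
    obtain ⟨p, hp⟩ := hconn.exists_walk_length_eq_dist x y
    exact ⟨p.map (doublingInr G D), (p.length_map _).trans hp⟩
  rcases u with x | x <;> rcases v with y | y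
  · exact walk_inl x y
  · obtain ⟨a, b, hab, hsum⟩ := hII x y
    obtain ⟨p, hp⟩ := walk_inl x a
    obtain ⟨q, hq⟩ := walk_inr b y
    refine ⟨p.append (SimpleGraph.Walk.cons (doubling_adj_inl_inr.2 hab) q), ?_⟩
    rw [SimpleGraph.Walk.length_append, SimpleGraph.Walk.length_cons, hp, hq,
      G.dist_comm (u := x), G.dist_comm (u := b)]
    simp only [doublingDist]
    omega
  · obtain ⟨a, b, hab, hsum⟩ := hII x y
    obtain ⟨p, hp⟩ := walk_inr x a
    obtain ⟨q, hq⟩ := walk_inl b y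
    refine ⟨p.append (SimpleGraph.Walk.cons (doubling_adj_inr_inl.2 hab) q), ?_⟩
    rw [SimpleGraph.Walk.length_append, SimpleGraph.Walk.length_cons, hp, hq,
      G.dist_comm (u := x), G.dist_comm (u := b)]
    simp only [doublingDist]
    omega
  · exact walk_inr x y

theorem dist_doubling (hconn : G.Connected) (hI : CondI G D) (hII : CondII G D)
    (u v : V ⊕ V) : (doubling G D).dist u v = doublingDist G D u v := by
  obtain ⟨p, hp⟩ := exists_walk_length_eq_doublingDist hconn hII u v
  obtain ⟨q, hq⟩ := p.reachable.exists_walk_length_eq_dist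
  have h_self : doublingDist G D u u = 0 := by rcases u with x | x <;> simp [doublingDist]
  have h_lower := doublingDist_le_length hconn hI hII q u
  have h_upper := SimpleGraph.dist_le p
  omega

end Doubling

section Cube

/-- Extend a vertex of the `n`-cube to a vertex of the `m`-cube by `false`. -/
def padFalse {n : ℕ} (m : ℕ) (a : Fin n → Bool) (i : Fin m) : Bool :=
  if hi : (i : ℕ) < n then a ⟨i, hi⟩ else false

lemma hammingDist_padFalse {n m : ℕ} (hnm : n ≤ m) (a b : Fin n → Bool) :
    hammingDist (padFalse m a) (padFalse m b) = hammingDist a b := by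
  unfold hammingDist
  rw [← Finset.card_map (Fin.castLEEmb hnm)]
  congr 1
  ext i
  simp only [Finset.mem_filter, Finset.mem_univ, true_and, Finset.mem_map]
  constructor
  · intro h
    by_cases hi : (i : ℕ) < n
    · exact ⟨⟨i, hi⟩, by simpa [padFalse, hi] using h, rfl⟩
    · simp [padFalse, hi] at h
  · rintro ⟨j, hj, rfl⟩
    simpa [padFalse] using hj

lemma hammingDist_not_not {ι : Type*} [Fintype ι] (a b : ι → Bool) :
    hammingDist (fun i => !a i) (fun i => !b i) = hammingDist a b := by
  simp [hammingDist]

lemma hammingDist_add_hammingDist_not {ι : Type*} [Fintype ι] (a b : ι → Bool) :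
    hammingDist a b + hammingDist a (fun i => !b i) = Fintype.card ι := by
  unfold hammingDist
  rw [← Finset.card_univ, ← Finset.card_filter_add_card_filter_not
    (s := Finset.univ) (fun i => a i ≠ b i)]
  congr 1
  refine congrArg Finset.card (Finset.filter_congr fun i _ => ?_)
  beta_reduce
  cases a i <;> cases b i <;> simp

end Cube

/-- If `Γ` is connected of diameter `D ≥ 1`, satisfies conditions (I) and (II), and
admits a scale-`t` embedding into the `n`-cube with `n ≤ t·(D+1)`, then `□Γ` admits an
equicut scale-`t` embedding into the `t·(D+1)`-cube: every coordinate takes the value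
`true` on exactly `v` of the `2v` vertices of `□Γ`. -/
theorem doubling_equicut_embedding {V : Type*} [Fintype V] [DecidableEq V]
    (G : SimpleGraph V) (hconn : G.Connected) (D : ℕ) (hD : 1 ≤ D)
    (hD1 : ∀ x y : V, G.dist x y ≤ D) (hD2 : ∃ x y : V, G.dist x y = D)
    (hI : CondI G D) (hII : CondII G D)
    (t n : ℕ) (g : V → (Fin n → Bool)) (hg : IsScaleEmbedding G t n g)
    (hn : n ≤ t * (D + 1)) :
    ∃ h : V ⊕ V → (Fin (t * (D + 1)) → Bool),
      IsScaleEmbedding (doubling G D) t (t * (D + 1)) h ∧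
      ∀ i : Fin (t * (D + 1)),
        (Finset.univ.filter (fun u : V ⊕ V => h u i = true)).card = Fintype.card V := by
  let e : V → Fin (t * (D + 1)) → Bool := fun x => padFalse _ (g x)
  have he : ∀ x y, hammingDist (e x) (e y) = t * G.dist x y := fun x y =>
    (hammingDist_padFalse hn (g x) (g y)).trans (hg x y)
  have he_not : ∀ x y, hammingDist (e x) (fun i => !e y i) = t * (D + 1 - G.dist x y) :=
    fun x y => by
      have h := hammingDist_add_hammingDist_not (e x) (e y)
      rw [he, Fintype.card_fin] at h
      rw [Nat.mul_sub]
      omega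
  refine ⟨Sum.elim e fun x i => !e x i, fun u v => ?_, fun i => ?_⟩
  · rw [dist_doubling hconn hI hII]
    rcases u with x | x <;> rcases v with y | y <;>
      simp only [Sum.elim_inl, Sum.elim_inr, doublingDist]
    · exact he x y
    · exact he_not x y
    · rw [hammingDist_comm, he_not, G.dist_comm]
    · rw [hammingDist_not_not, he]
  · rw [Finset.card_filter, Fintype.sum_sum_type, ← Finset.sum_add_distrib,
      ← Finset.card_univ, Finset.card_eq_sum_ones]
    refine Finset.sum_congr rfl fun x _ => ?_
    simp only [Sum.elim_inl, Sum.elim_inr]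
    by_cases hx : e x i = true <;> simp [hx]
end
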